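/- Let a ∈ (0,1) and ã ∈ (0,1], and define h(x) = (F⁻¹(x) − a·F⁻¹(ã x))/(1 − a) for x ∈ ℝ. If f is nondecreasing on (−∞,0] and nonincreasing on [0,∞), then h is an increasing bijection of ℝ onto ℝ, and for every x ∈ ℝ one has h(x) ≥ ((1−aã)/(1−a))·F⁻¹(x) when x ≥ 0 and h(x) ≤ ((1−aã)/(1−a))·F⁻¹(x) when x ≤ 0. -/

import Mathlib

open MeasureTheory Filter

/-- `F(y) = ∫_0^y f(x) dx`. -/
noncomputable def Fint (f : ℝ → ℝ) (y : ℝ) : ℝ := ∫ x in (0:ℝ)..y, f x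

/-- `h(x) = (F⁻¹(x) − a·F⁻¹(ã x))/(1 − a)`, where `Finv` plays the role of `F⁻¹`. -/
noncomputable def hFun (Finv : ℝ → ℝ) (a atil x : ℝ) : ℝ :=
  (Finv x - a * Finv (atil * x)) / (1 - a)

theorem hasDerivAt_Fint {f : ℝ → ℝ} (hf : Continuous f) (y : ℝ) :
    HasDerivAt (Fint f) (f y) y :=
  intervalIntegral.integral_hasDerivAt_right (hf.intervalIntegrable _ _)
    (hf.stronglyMeasurableAtFilter _ _) hf.continuousAt

theorem strictMono_Fint {f : ℝ → ℝ} (hf : Continuous f) (hfpos : ∀ x, 0 < f x) :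
    StrictMono (Fint f) :=
  strictMono_of_deriv_pos fun x => by
    rw [(hasDerivAt_Fint hf x).deriv]
    exact hfpos x

/-- `c * g x - g (c * x)` is monotone for `c ∈ (0, 1]` when the derivative `1 / f (g x)`
of `g` is nondecreasing in `|x|`. -/
theorem monotone_mul_sub_comp_mul {f g : ℝ → ℝ} (hfpos : ∀ x, 0 < f x)
    (hg : Monotone g) (hg0 : g 0 = 0) (hgd : ∀ x, HasDerivAt g (f (g x))⁻¹ x)
    (hfmono : MonotoneOn f (Set.Iic 0)) (hfanti : AntitoneOn f (Set.Ici 0))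
    {c : ℝ} (hc : c ∈ Set.Ioc (0 : ℝ) 1) :
    Monotone fun x => c * g x - g (c * x) := by
  have hd : ∀ x, HasDerivAt (fun x => c * g x - g (c * x))
      (c * (f (g x))⁻¹ - (f (g (c * x)))⁻¹ * c) x := fun x =>
    ((hgd x).const_mul c).sub
      ((hgd (c * x)).comp x (by simpa using (hasDerivAt_id x).const_mul c))
  refine monotone_of_deriv_nonneg (fun x => (hd x).differentiableAt) fun x => ?_
  rw [(hd x).deriv]
  have hle : f (g x) ≤ f (g (c * x)) := by
    rcases le_total 0 x with hx | hx
    · have h1 : 0 ≤ g (c * x) := hg0 ▸ hg (mul_nonneg hc.1.le hx)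
      have h2 : g (c * x) ≤ g x := hg (mul_le_of_le_one_left hx hc.2)
      exact hfanti h1 (h1.trans h2) h2
    · have h1 : g (c * x) ≤ 0 := hg0 ▸ hg (mul_nonpos_of_nonneg_of_nonpos hc.1.le hx)
      have h2 : g x ≤ g (c * x) := hg (by nlinarith [hc.2])
      exact hfmono (h2.trans h1) h1 h2
  have hinv : (f (g (c * x)))⁻¹ ≤ (f (g x))⁻¹ := inv_anti₀ (hfpos _) hle
  nlinarith [hc.1]

theorem stmt9 (f Finv : ℝ → ℝ)
    (hf : Continuous f) (hfpos : ∀ x, 0 < f x)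
    (hFbot : Tendsto (Fint f) atBot atBot) (hFtop : Tendsto (Fint f) atTop atTop)
    (hFinv1 : ∀ y, Fint f (Finv y) = y) (hFinv2 : ∀ y, Finv (Fint f y) = y)
    (hfmono : MonotoneOn f (Set.Iic 0)) (hfanti : AntitoneOn f (Set.Ici 0))
    (a atil : ℝ) (ha : a ∈ Set.Ioo (0:ℝ) 1) (hatil : atil ∈ Set.Ioc (0:ℝ) 1) :
    StrictMono (hFun Finv a atil) ∧ Function.Bijective (hFun Finv a atil) ∧
    (∀ x, 0 ≤ x → ((1 - a * atil) / (1 - a)) * Finv x ≤ hFun Finv a atil x) ∧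
    (∀ x, x ≤ 0 → hFun Finv a atil x ≤ ((1 - a * atil) / (1 - a)) * Finv x) := by
  have hF := strictMono_Fint hf hfpos
  have hg : StrictMono Finv := fun x y hxy => by
    rwa [← hF.lt_iff_lt, hFinv1, hFinv1]
  have hgsurj : Function.Surjective Finv := fun y => ⟨_, hFinv2 y⟩
  have hgc : Continuous Finv := hg.monotone.continuous_of_surjective hgsurj
  have hg0 : Finv 0 = 0 := by simpa [Fint] using hFinv2 0
  have hgd : ∀ x, HasDerivAt Finv (f (Finv x))⁻¹ x := fun x =>
    (hasDerivAt_Fint hf (Finv x)).of_local_left_inverse hgc.continuousAt (hfpos _).ne'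
      (Eventually.of_forall hFinv1)
  have hφ := monotone_mul_sub_comp_mul hfpos hg.monotone hg0 hgd hfmono hfanti hatil
  have ha1 : 0 < 1 - a := sub_pos.2 ha.2
  have hk : 0 < (1 - a * atil) / (1 - a) :=
    div_pos (by nlinarith [ha.1, ha.2, hatil.2]) ha1
  have hr : 0 < a / (1 - a) := div_pos ha.1 ha1
  have hh : ∀ x, hFun Finv a atil x = (1 - a * atil) / (1 - a) * Finv x +
      a / (1 - a) * (atil * Finv x - Finv (atil * x)) := fun x => by
    unfold hFun
    field_simp
    ring
  have hφ0 : atil * Finv 0 - Finv (atil * 0) = 0 := by simp [hg0]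
  have hlower : ∀ x, 0 ≤ x → (1 - a * atil) / (1 - a) * Finv x ≤ hFun Finv a atil x :=
    fun x hx => by
      rw [hh]
      exact le_add_of_nonneg_right (mul_nonneg hr.le (hφ0 ▸ hφ hx))
  have hupper : ∀ x, x ≤ 0 → hFun Finv a atil x ≤ (1 - a * atil) / (1 - a) * Finv x :=
    fun x hx => by
      rw [hh]
      exact add_le_of_nonpos_right (mul_nonpos_of_nonneg_of_nonpos hr.le (hφ0 ▸ hφ hx))
  have hmono : StrictMono (hFun Finv a atil) := fun x y hxy => by
    rw [hh, hh]
    exact add_lt_add_of_lt_of_le (mul_lt_mul_of_pos_left (hg hxy) hk)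
      (mul_le_mul_of_nonneg_left (hφ hxy.le) hr.le)
  have hcont : Continuous (hFun Finv a atil) := by
    unfold hFun
    fun_prop
  have htop : Tendsto Finv atTop atTop :=
    hg.monotone.tendsto_atTop_atTop fun b => ⟨_, (hFinv2 b).ge⟩
  have hbot : Tendsto Finv atBot atBot :=
    hg.monotone.tendsto_atBot_atBot fun b => ⟨_, (hFinv2 b).le⟩
  refine ⟨hmono, ⟨hmono.injective, hcont.surjective ?_ ?_⟩, hlower, hupper⟩
  · exact tendsto_atTop_mono' _ ((eventually_ge_atTop 0).mono hlower) (htop.const_mul_atTop hk)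
  · exact tendsto_atBot_mono' _ ((eventually_le_atBot 0).mono hupper) (hbot.const_mul_atBot hk)
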